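/- arXiv:0801.0777 — 2 statements merged into one kernel-verified Lean document; each statement's English description precedes it below -/
import Mathlib

section
/- Let (Ω, Σ, μ) be a probability space and let a_n : L∞(Ω, μ; ℝ) → L⁰(Ω, μ; ℝ) be a sequence of positive linear maps, each continuous with respect to convergence in measure, with a_n(1) ≤ 1 almost everywhere for all n. If for every x ∈ L∞ with ‖x‖_∞ ≤ 1 the sequence (a_n(x)) converges almost uniformly, then the sequence (a_n) is uniformly equicontinuous at 0 on the unit ball {x ∈ L∞ : ‖x‖_∞ ≤ 1}. -/
open MeasureTheory Filter Topology
open scoped ENNReal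

/-- A sequence of real-valued measurable functions converges almost uniformly:
for every `ε > 0` there is a measurable set `E` with `μ(Eᶜ) < ε` on which the sequence
converges uniformly (to some limit function `g`). -/
def ConvergesAU {Ω : Type*} [MeasurableSpace Ω] (μ : Measure Ω) (f : ℕ → Ω → ℝ) : Prop :=
  ∃ g : Ω → ℝ, ∀ ε : ℝ, 0 < ε → ∃ E : Set Ω, MeasurableSet E ∧
    μ Eᶜ < ENNReal.ofReal ε ∧ TendstoUniformlyOn f g atTop E

/-- The sequence of maps `aₙ : L∞ → L⁰` is uniformly equicontinuous at `0` on the set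
`E ⊆ L∞`: for every `ε, δ > 0` there are `γ, η > 0` such that for every `x ∈ E` with
`μ{|x| > γ} < η` there is a measurable set `F` with `μ(Fᶜ) < ε` and
`supₙ ‖aₙ(x)·1_F‖_∞ < δ`. -/
def UnifEquicontAtZeroOn {Ω : Type*} [MeasurableSpace Ω] (μ : Measure Ω)
    (a : ℕ → (Ω → ℝ) → Ω → ℝ) (E : Set (Ω → ℝ)) : Prop :=
  ∀ ε δ : ℝ, 0 < ε → 0 < δ → ∃ γ η : ℝ, 0 < γ ∧ 0 < η ∧
    ∀ x ∈ E, μ {ω | γ < |x ω|} < ENNReal.ofReal η →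
      ∃ F : Set Ω, MeasurableSet F ∧ μ Fᶜ < ENNReal.ofReal ε ∧
        (⨆ n, eLpNorm (F.indicator (a n x)) ⊤ μ) < ENNReal.ofReal δ

/-- The ball of radius `d` in real `L∞`. -/
def LinftyBall {Ω : Type*} [MeasurableSpace Ω] (μ : Measure Ω) (d : ℝ) :
    Set (Ω → ℝ) :=
  {x | Measurable x ∧ eLpNorm x ⊤ μ ≤ ENNReal.ofReal d}

section BanachPrinciple

variable {Ω : Type*} [MeasurableSpace Ω] {μ : Measure Ω}

theorem tendstoInMeasure_sub {f g : ℕ → Ω → ℝ} {f' g' : Ω → ℝ}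
    (hf : TendstoInMeasure μ f atTop f') (hg : TendstoInMeasure μ g atTop g') :
    TendstoInMeasure μ (fun k => f k - g k) atTop (f' - g') := by
  rw [tendstoInMeasure_iff_norm] at *
  intro ε hε
  have h := (hf (ε / 2) (half_pos hε)).add (hg (ε / 2) (half_pos hε))
  rw [add_zero] at h
  refine tendsto_of_tendsto_of_tendsto_of_le_of_le tendsto_const_nhds h (fun _ => zero_le) ?_
  intro k
  refine (measure_mono ?_).trans (measure_union_le _ _)
  intro ω hω
  simp only [Set.mem_union, Set.mem_ofPred_eq, Pi.sub_apply, Real.norm_eq_abs] at hω ⊢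
  by_contra! hlt
  have := abs_sub (f k ω - f' ω) (g k ω - g' ω)
  rw [show f k ω - g k ω - (f' ω - g' ω) = f k ω - f' ω - (g k ω - g' ω) by ring] at hω
  linarith

/-- The maximal tail bound `μ {supₙ |Yₙ| > δ} ≤ c` is preserved by convergence in measure of each
term of the sequence. -/
theorem measure_exists_lt_abs_le_of_tendstoInMeasure {X : ℕ → ℕ → Ω → ℝ} {Y : ℕ → Ω → ℝ}
    {δ : ℝ} {c : ℝ≥0∞} (h : ∀ n, TendstoInMeasure μ (fun j => X j n) atTop (Y n))
    (hX : ∀ j, μ {ω | ∃ n, δ < |X j n ω|} ≤ c) :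
    μ {ω | ∃ n, δ < |Y n ω|} ≤ c := by
  simp only [tendstoInMeasure_iff_norm] at h
  let B : ℕ → Set Ω := fun N => {ω | ∃ n ∈ Finset.range N, δ + 1 / ((N : ℝ) + 1) < |Y n ω|}
  have hB : {ω | ∃ n, δ < |Y n ω|} = ⋃ N, B N := by
    ext ω
    simp only [Set.mem_ofPred_eq, Set.mem_iUnion, B, Finset.mem_range]
    constructor
    · rintro ⟨n, hn⟩
      obtain ⟨k, hk⟩ := exists_nat_one_div_lt (sub_pos.2 hn)
      refine ⟨max (n + 1) k, n, by simp, ?_⟩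
      have : 1 / (((max (n + 1) k : ℕ) : ℝ) + 1) ≤ 1 / ((k : ℝ) + 1) :=
        one_div_le_one_div_of_le (by positivity)
          (by gcongr; exact le_max_right _ _)
      linarith
    · rintro ⟨N, n, -, hn⟩
      have : 0 < 1 / ((N : ℝ) + 1) := by positivity
      exact ⟨n, by linarith⟩
  have hmono : Monotone B := by
    rintro M N hMN ω ⟨n, hn, hlt⟩
    have : 1 / ((N : ℝ) + 1) ≤ 1 / ((M : ℝ) + 1) :=
      one_div_le_one_div_of_le (by positivity) (by gcongr)
    exact ⟨n, Finset.range_mono hMN hn, by linarith⟩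
  rw [hB, hmono.measure_iUnion]
  refine iSup_le fun N => ?_
  have hpos : 0 < 1 / ((N : ℝ) + 1) := by positivity
  have hlim := (tendsto_finsetSum (Finset.range N) fun n _ => h n _ hpos).const_add c
  simp only [Finset.sum_const_zero, add_zero] at hlim
  refine ge_of_tendsto' hlim fun j => ?_
  refine le_trans (measure_mono ?_) ((measure_union_le _ _).trans
    (add_le_add (hX j) (measure_biUnion_finset_le _ _)))
  rintro ω ⟨n, hn, hlt⟩
  by_cases hj : δ < |X j n ω|
  · exact Or.inl ⟨n, hj⟩
  · refine Or.inr (Set.mem_biUnion hn ?_)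
    simp only [Set.mem_ofPred_eq, Real.norm_eq_abs]
    have := abs_sub_abs_le_abs_sub (Y n ω) (X j n ω)
    rw [abs_sub_comm] at this
    linarith

theorem mem_LinftyBall_of_abs_le {x : Ω → ℝ} {d : ℝ} (hx : Measurable x)
    (h : ∀ᵐ ω ∂μ, |x ω| ≤ d) : x ∈ LinftyBall μ d := by
  refine ⟨hx, ?_⟩
  rw [eLpNorm_exponent_top]
  exact eLpNormEssSup_le_of_ae_bound h

theorem abs_le_of_mem_LinftyBall {x : Ω → ℝ} {d : ℝ} (hd : 0 ≤ d) (hx : x ∈ LinftyBall μ d) :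
    ∀ᵐ ω ∂μ, |x ω| ≤ d := by
  have h := hx.2
  rw [eLpNorm_exponent_top] at h
  filter_upwards [ae_le_eLpNormEssSup (f := x) (μ := μ)] with ω hω
  have := hω.trans h
  rw [← ofReal_norm, ENNReal.ofReal_le_ofReal_iff hd] at this
  exact this

/-- Every `y` in the unit ball is a difference of two elements of the unit ball lying within `|y|`
of a prescribed element of the ball. -/
theorem exists_mem_LinftyBall_add_mem_abs_sub_le {x y : Ω → ℝ} (hx : x ∈ LinftyBall μ 1)
    (hy : y ∈ LinftyBall μ 1) :
    ∃ z ∈ LinftyBall μ 1, z + y ∈ LinftyBall μ 1 ∧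
      (∀ᵐ ω ∂μ, |z ω - x ω| ≤ |y ω|) ∧ ∀ᵐ ω ∂μ, |(z + y) ω - x ω| ≤ |y ω| := by
  have hxm := hx.1
  have hym := hy.1
  let z : Ω → ℝ := fun ω => max (max (-1) (-1 - y ω)) (min (x ω) (min 1 (1 - y ω)))
  have hz : Measurable z := by fun_prop
  have key : ∀ᵐ ω ∂μ, |z ω| ≤ 1 ∧ |(z + y) ω| ≤ 1 ∧ |z ω - x ω| ≤ |y ω| ∧
      |(z + y) ω - x ω| ≤ |y ω| := by
    filter_upwards [abs_le_of_mem_LinftyBall zero_le_one hx,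
      abs_le_of_mem_LinftyBall zero_le_one hy] with ω h1 h2
    simp only [z, Pi.add_apply]
    grind
  refine ⟨z, mem_LinftyBall_of_abs_le hz (key.mono fun _ h => h.1),
    mem_LinftyBall_of_abs_le (hz.add hym) (key.mono fun _ h => h.2.1),
    key.mono fun _ h => h.2.2.1, key.mono fun _ h => h.2.2.2⟩

theorem eLpNorm_one_le_of_mem_LinftyBall [IsProbabilityMeasure μ] {y : Ω → ℝ} {γ : ℝ}
    (hy : y ∈ LinftyBall μ 1) :
    eLpNorm y 1 μ ≤ ENNReal.ofReal γ + μ {ω | γ < |y ω|} := by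
  have hm : MeasurableSet {ω | γ < |y ω|} := measurableSet_lt measurable_const hy.1.norm
  rw [eLpNorm_one_eq_lintegral_enorm]
  calc ∫⁻ ω, ‖y ω‖ₑ ∂μ
      ≤ ∫⁻ ω, (ENNReal.ofReal γ + {ω | γ < |y ω|}.indicator 1 ω) ∂μ := by
        refine lintegral_mono_ae ?_
        filter_upwards [abs_le_of_mem_LinftyBall zero_le_one hy] with ω hω
        rw [← ofReal_norm, Real.norm_eq_abs]
        by_cases h : γ < |y ω|
        · rw [Set.indicator_of_mem (show ω ∈ {ω | γ < |y ω|} from h)]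
          exact le_add_left (by simpa using hω)
        · exact le_add_right (ENNReal.ofReal_le_ofReal (not_lt.1 h))
    _ = _ := by
        rw [lintegral_add_left measurable_const, lintegral_indicator_one hm]
        simp

theorem tendstoInMeasure_zero_of_measure_lt {y : ℕ → Ω → ℝ} {γ : ℕ → ℝ}
    (hγ : Tendsto γ atTop (𝓝 0))
    (hy : ∀ k, μ {ω | γ k < |y k ω|} ≤ ENNReal.ofReal (γ k)) :
    TendstoInMeasure μ y atTop 0 := by
  rw [tendstoInMeasure_iff_norm]
  intro ε hε
  have h0 : Tendsto (fun k => ENNReal.ofReal (γ k)) atTop (𝓝 0) := by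
    simpa using ENNReal.tendsto_ofReal hγ
  refine tendsto_of_tendsto_of_tendsto_of_le_of_le' tendsto_const_nhds h0
    (.of_forall fun _ => zero_le) ?_
  filter_upwards [hγ.eventually_lt_const hε] with k hk
  refine (measure_mono fun ω hω => ?_).trans (hy k)
  simp only [Set.mem_ofPred_eq, Pi.zero_apply, sub_zero, Real.norm_eq_abs] at hω ⊢
  linarith

/-- An almost uniformly convergent sequence is uniformly Cauchy off a set of small measure. -/
theorem ConvergesAU.exists_measure_le {f : ℕ → Ω → ℝ} (hf : ConvergesAU μ f) {δ ε : ℝ}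
    (hδ : 0 < δ) (hε : 0 < ε) :
    ∃ m, μ {ω | ∃ n, δ < |f (m + n) ω - f m ω|} ≤ ENNReal.ofReal ε := by
  obtain ⟨g, hg⟩ := hf
  obtain ⟨E, -, hE, hu⟩ := hg ε hε
  rw [Metric.tendstoUniformlyOn_iff] at hu
  obtain ⟨m, hm⟩ := eventually_atTop.1 (hu (δ / 2) (half_pos hδ))
  refine ⟨m, (measure_mono ?_).trans hE.le⟩
  rintro ω ⟨n, hn⟩ hωE
  have h1 := hm (m + n) (Nat.le_add_right _ _) ω hωE
  have h2 := hm m le_rfl ω hωE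
  rw [dist_comm] at h1
  have h3 := dist_triangle (f (m + n) ω) (g ω) (f m ω)
  rw [Real.dist_eq (f (m + n) ω) (f m ω)] at h3
  linarith

theorem isClosed_setOf_coeFn_mem_LinftyBall (d : ℝ) :
    IsClosed {f : Lp ℝ 1 μ | ⇑f ∈ LinftyBall μ d} := by
  refine IsSeqClosed.isClosed fun f g hf hg => ?_
  refine ⟨(Lp.stronglyMeasurable g).measurable, ?_⟩
  refine eLpNorm_le_of_tendstoInMeasure (.of_forall fun n => (hf n).2)
    (tendstoInMeasure_of_tendsto_Lp hg) fun n => Lp.aestronglyMeasurable _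

/-- Baire category step: pointwise almost uniform convergence on the unit ball gives a uniform tail
bound on an `L¹`-neighbourhood of some element of the ball. -/
theorem exists_measure_le_on_nhds
    {a : ℕ → (Ω → ℝ) → Ω → ℝ}
    (hwd : ∀ n, ∀ x ∈ LinftyBall μ 1, ∀ y ∈ LinftyBall μ 1, x =ᵐ[μ] y → a n x =ᵐ[μ] a n y)
    (hcont : ∀ n (u : ℕ → Ω → ℝ), (∀ k, u k ∈ LinftyBall μ 1) → ∀ x ∈ LinftyBall μ 1,
      TendstoInMeasure μ u atTop x → TendstoInMeasure μ (fun k => a n (u k)) atTop (a n x))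
    (hconv : ∀ x ∈ LinftyBall μ 1, ConvergesAU μ (fun n => a n x))
    [IsProbabilityMeasure μ] {δ ε : ℝ} (hδ : 0 < δ) (hε : 0 < ε) :
    ∃ x ∈ LinftyBall μ 1, ∃ m, ∃ r : ℝ, 0 < r ∧ ∀ z ∈ LinftyBall μ 1,
      eLpNorm (z - x) 1 μ < ENNReal.ofReal r →
      μ {ω | ∃ n, δ < |a (m + n) z ω - a m z ω|} ≤ ENNReal.ofReal ε := by
  let S : Set (Lp ℝ 1 μ) := {f | ⇑f ∈ LinftyBall μ 1}
  have hS : IsClosed S := isClosed_setOf_coeFn_mem_LinftyBall 1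
  have : CompleteSpace S := hS.completeSpace_coe
  have : Nonempty S := ⟨0, mem_LinftyBall_of_abs_le (Lp.stronglyMeasurable _).measurable <| by
    filter_upwards [Lp.coeFn_zero ℝ 1 μ] with ω hω
    rw [hω]
    simp⟩
  let C : ℕ → Set S := fun m =>
    {f | μ {ω | ∃ n, δ < |a (m + n) f.1 ω - a m f.1 ω|} ≤ ENNReal.ofReal ε}
  have hC : ∀ m, IsClosed (C m) := by
    refine fun m => IsSeqClosed.isClosed fun f g hf hg => ?_
    have hfg : TendstoInMeasure μ (fun k => ⇑(f k).1) atTop g.1 :=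
      tendstoInMeasure_of_tendsto_Lp ((continuous_subtype_val.tendsto g).comp hg)
    have ht : ∀ n, TendstoInMeasure μ (fun k => a n (f k).1) atTop (a n g.1) := fun n =>
      hcont n _ (fun k => (f k).2) _ g.2 hfg
    exact measure_exists_lt_abs_le_of_tendstoInMeasure
      (X := fun j n => a (m + n) (f j).1 - a m (f j).1) (Y := fun n => a (m + n) g.1 - a m g.1)
      (fun n => tendstoInMeasure_sub (ht _) (ht _)) hf
  have hU : ⋃ m, C m = Set.univ := Set.eq_univ_of_forall fun f =>
    Set.mem_iUnion.2 ((hconv _ f.2).exists_measure_le hδ hε)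
  obtain ⟨m, f, hf⟩ := nonempty_interior_of_iUnion_of_closed hC hU
  obtain ⟨r, hr, hball⟩ := Metric.mem_nhds_iff.1 (mem_interior_iff_mem_nhds.1 hf)
  refine ⟨f.1, f.2, m, r, hr, fun z hz hzr => ?_⟩
  have hzL : MemLp z 1 μ :=
    MemLp.of_bound hz.1.aestronglyMeasurable 1 (abs_le_of_mem_LinftyBall zero_le_one hz)
  have hzz : ⇑(hzL.toLp z) =ᵐ[μ] z := hzL.coeFn_toLp
  have hmem : ⇑(hzL.toLp z) ∈ LinftyBall μ 1 :=
    ⟨(Lp.stronglyMeasurable _).measurable, (eLpNorm_congr_ae hzz).trans_le hz.2⟩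
  have hdist : (⟨hzL.toLp z, hmem⟩ : S) ∈ Metric.ball f r := by
    rw [← Metric.eball_ofReal, Metric.mem_eball, Subtype.edist_eq, Lp.edist_def]
    rwa [eLpNorm_congr_ae (hzz.sub (ae_eq_refl _))]
  refine le_trans (measure_mono_ae ?_) (hball hdist)
  have hae : ∀ᵐ ω ∂μ, ∀ n, a n (hzL.toLp z) ω = a n z ω :=
    ae_all_iff.2 fun n => hwd n _ hmem _ hz hzz
  filter_upwards [hae] with ω hω
  rintro ⟨n, hn⟩
  exact ⟨n, by simpa only [hω] using hn⟩

end BanachPrinciple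

/-- Commutative case of the paper's Theorem 5: let `aₙ : L∞ → L⁰` be positive linear
maps over a probability space, continuous with respect to convergence in measure, with
`aₙ(1) ≤ 1` a.e. If `(aₙ(x))ₙ` converges almost uniformly for every `x` in the unit
ball of `L∞`, then the sequence `(aₙ)` is uniformly equicontinuous at `0` on the unit
ball. -/
theorem theorem5_commutative_case
    {Ω : Type*} [MeasurableSpace Ω] (μ : Measure Ω) [IsProbabilityMeasure μ]
    (a : ℕ → (Ω → ℝ) → Ω → ℝ)
    (hmeas : ∀ n x, Measurable x → eLpNorm x ⊤ μ < ⊤ → Measurable (a n x))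
    (hwd : ∀ n x y, Measurable x → Measurable y → eLpNorm x ⊤ μ < ⊤ →
      eLpNorm y ⊤ μ < ⊤ → x =ᵐ[μ] y → a n x =ᵐ[μ] a n y)
    (hadd : ∀ n x y, Measurable x → Measurable y → eLpNorm x ⊤ μ < ⊤ →
      eLpNorm y ⊤ μ < ⊤ → a n (x + y) =ᵐ[μ] a n x + a n y)
    (hsmul : ∀ n (c : ℝ) x, Measurable x → eLpNorm x ⊤ μ < ⊤ →
      a n (c • x) =ᵐ[μ] c • a n x)
    (hpos : ∀ n x, Measurable x → eLpNorm x ⊤ μ < ⊤ →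
      (0 : Ω → ℝ) ≤ᵐ[μ] x → (0 : Ω → ℝ) ≤ᵐ[μ] a n x)
    (hcont : ∀ n (u : ℕ → Ω → ℝ) (x : Ω → ℝ),
      (∀ k, Measurable (u k) ∧ eLpNorm (u k) ⊤ μ < ⊤) →
      Measurable x → eLpNorm x ⊤ μ < ⊤ →
      TendstoInMeasure μ u atTop x →
      TendstoInMeasure μ (fun k => a n (u k)) atTop (a n x))
    (hone : ∀ n, a n (fun _ => (1 : ℝ)) ≤ᵐ[μ] (fun _ => (1 : ℝ)))
    (hconv : ∀ x ∈ LinftyBall μ 1, ConvergesAU μ (fun n => a n x)) :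
    UnifEquicontAtZeroOn μ a (LinftyBall μ 1) := by
  intro ε δ hε hδ
  have htop : ∀ {x}, x ∈ LinftyBall μ 1 → eLpNorm x ⊤ μ < ⊤ := fun hx =>
    hx.2.trans_lt ENNReal.ofReal_lt_top
  obtain ⟨x, hx, m, r, hr, htail⟩ := exists_measure_le_on_nhds (μ := μ) (a := a)
    (fun n x hx y hy => hwd n x y hx.1 hy.1 (htop hx) (htop hy))
    (fun n u hu x hx => hcont n u x (fun k => ⟨(hu k).1, htop (hu k)⟩) hx.1 (htop hx))
    hconv (δ := δ / 4) (ε := ε / 4) (by positivity) (by positivity)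
  by_contra! hcon
  have hγpos : ∀ k : ℕ, 0 < 1 / ((k : ℝ) + 1) := fun k => by positivity
  choose y hy hyγ hF using fun k : ℕ => hcon _ _ (hγpos k) (hγpos k)
  have hγ : Tendsto (fun k : ℕ => 1 / ((k : ℝ) + 1)) atTop (𝓝 0) :=
    tendsto_one_div_add_atTop_nhds_zero_nat
  have hy0 : TendstoInMeasure μ y atTop 0 :=
    tendstoInMeasure_zero_of_measure_lt hγ fun k => (hyγ k).le
  have ha0 : ∀ n, a n 0 =ᵐ[μ] 0 := fun n => by
    simpa using hsmul n 0 0 measurable_zero (by simp)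
  have hay : ∀ n, TendstoInMeasure μ (fun k => a n (y k)) atTop 0 := fun n =>
    (hcont n y 0 (fun k => ⟨(hy k).1, htop (hy k)⟩) measurable_zero (by simp) hy0).congr_right
      (ha0 n)
  simp only [tendstoInMeasure_iff_norm] at hay
  have hfin := tendsto_finsetSum (Finset.range (m + 1)) fun n _ =>
    hay n (δ / 4) (by positivity)
  simp only [Finset.sum_const_zero, Pi.zero_apply, sub_zero, Real.norm_eq_abs] at hfin
  obtain ⟨k, hk1, hk2⟩ := ((hfin.eventually_lt_const
    (ENNReal.ofReal_pos.2 (by positivity : 0 < ε / 4))).and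
    (hγ.eventually_lt_const (half_pos hr))).exists
  have hyr : eLpNorm (y k) 1 μ < ENNReal.ofReal r := by
    calc eLpNorm (y k) 1 μ
        ≤ ENNReal.ofReal (1 / ((k : ℝ) + 1)) + ENNReal.ofReal (1 / ((k : ℝ) + 1)) :=
          (eLpNorm_one_le_of_mem_LinftyBall (hy k)).trans
            (add_le_add le_rfl (hyγ k).le)
      _ < ENNReal.ofReal r := by
          rw [← ENNReal.ofReal_add (hγpos k).le (hγpos k).le, ENNReal.ofReal_lt_ofReal_iff hr]
          linarith
  obtain ⟨z, hz, hzy, hzx, hzyx⟩ := exists_mem_LinftyBall_add_mem_abs_sub_le hx (hy k)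
  have hbad₁ := htail z hz ((eLpNorm_mono_ae hzx).trans_lt hyr)
  have hbad₂ := htail (z + y k) hzy ((eLpNorm_mono_ae hzyx).trans_lt hyr)
  have hyk : ∀ n, Measurable (a n (y k)) := fun n => hmeas n _ (hy k).1 (htop (hy k))
  let F : Set Ω := {ω | ∀ n, |a n (y k) ω| ≤ 3 * (δ / 4)}
  have hFm : MeasurableSet F := by
    simp only [F, Set.ofPred_forall]
    exact MeasurableSet.iInter fun n => measurableSet_le (hyk n).norm measurable_const
  have hFc : μ Fᶜ < ENNReal.ofReal ε := by
    have hsub : Fᶜ ≤ᵐ[μ] (({ω | ∃ n, δ / 4 < |a (m + n) z ω - a m z ω|} ∪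
        {ω | ∃ n, δ / 4 < |a (m + n) (z + y k) ω - a m (z + y k) ω|}) ∪
        ⋃ n ∈ Finset.range (m + 1), {ω | δ / 4 ≤ |a n (y k) ω|} : Set Ω) := by
      have hadd' : ∀ᵐ ω ∂μ, ∀ n, a n (z + y k) ω = a n z ω + a n (y k) ω :=
        ae_all_iff.2 fun n => hadd n z (y k) hz.1 (hy k).1 (htop hz) (htop (hy k))
      filter_upwards [hadd'] with ω hω hωF
      change ω ∈ Fᶜ at hωF
      change ω ∈ (_ : Set Ω)
      by_contra hnot
      simp only [Set.mem_union, Set.mem_ofPred_eq, Set.mem_iUnion, Finset.mem_range,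
        not_or, not_exists, not_lt, not_le, hω] at hnot
      obtain ⟨⟨h1, h2⟩, h3⟩ := hnot
      refine hωF fun n => ?_
      rcases lt_or_ge n (m + 1) with hn | hn
      · linarith [h3 n hn]
      · obtain ⟨j, rfl⟩ := Nat.exists_eq_add_of_le (Nat.le_of_succ_le hn)
        have := h3 m (Nat.lt_succ_self m)
        have h1 := h1 j
        have h2 := h2 j
        grind
    calc μ Fᶜ ≤ (ENNReal.ofReal (ε / 4) + ENNReal.ofReal (ε / 4)) +
          ∑ n ∈ Finset.range (m + 1), μ {ω | δ / 4 ≤ |a n (y k) ω|} :=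
          (measure_mono_ae hsub).trans <| (measure_union_le _ _).trans <| add_le_add
            ((measure_union_le _ _).trans (add_le_add hbad₁ hbad₂))
            (measure_biUnion_finset_le _ _)
      _ ≤ (ENNReal.ofReal (ε / 4) + ENNReal.ofReal (ε / 4)) + ENNReal.ofReal (ε / 4) := by
          gcongr
      _ < ENNReal.ofReal ε := by
          rw [← ENNReal.ofReal_add (by positivity) (by positivity),
            ← ENNReal.ofReal_add (by positivity) (by positivity),
            ENNReal.ofReal_lt_ofReal_iff hε]
          linarith
  refine (hF k F hFm hFc).not_gt (lt_of_le_of_lt (iSup_le fun n => ?_)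
    ((ENNReal.ofReal_lt_ofReal_iff hδ).2 (by linarith : 3 * (δ / 4) < δ)))
  rw [eLpNorm_exponent_top]
  refine eLpNormEssSup_le_of_ae_bound (ae_of_all _ fun ω => ?_)
  by_cases hω : ω ∈ F
  · rw [Set.indicator_of_mem hω]
    exact hω n
  · rw [Set.indicator_of_notMem hω, norm_zero]
    positivity
end

section
/- Let (Ω, Σ, μ) be a probability space and let a_n : L∞(Ω, μ; ℝ) → L⁰(Ω, μ; ℝ) be a sequence of additive maps that is uniformly equicontinuous at 0 on the unit ball B_1 = {x ∈ L∞ : ‖x‖_∞ ≤ 1}. Then the set C = {x ∈ B_1 : the sequence (a_n(x)) converges almost uniformly} is closed in B_1 with respect to convergence in measure: if (x_k) ⊂ C, x ∈ B_1, and x_k → x in measure, then x ∈ C. -/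
open MeasureTheory Filter Topology
open scoped ENNReal

/-- An almost uniform Cauchy criterion. -/
theorem convergesAU_of_forall_exists_abs_sub_lt {Ω : Type*} [MeasurableSpace Ω] {μ : Measure Ω}
    {f : ℕ → Ω → ℝ}
    (h : ∀ ε δ : ℝ, 0 < ε → 0 < δ → ∃ E : Set Ω, MeasurableSet E ∧ μ Eᶜ < ENNReal.ofReal ε ∧
      ∃ N, ∀ m ≥ N, ∀ n ≥ N, ∀ ω ∈ E, |f m ω - f n ω| < δ) :
    ConvergesAU μ f := by
  refine ⟨fun ω => limUnder atTop fun n => f n ω, fun ε hε => ?_⟩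
  obtain ⟨ε', hε', hsum⟩ := ENNReal.exists_pos_sum_of_countable
    (ENNReal.ofReal_pos.2 hε).ne' ℕ
  choose E hEm hEμ N hN using fun k : ℕ =>
    h (ε' k) (1 / ((k : ℝ) + 1)) (hε' k) Nat.one_div_pos_of_nat
  have hcauchy : UniformCauchySeqOn f atTop (⋂ k, E k) := by
    refine Metric.uniformCauchySeqOn_iff.2 fun δ hδ => ?_
    obtain ⟨k, hk⟩ := exists_nat_one_div_lt hδ
    exact ⟨N k, fun m hm n hn ω hω =>
      (hN k m hm n hn ω (Set.mem_iInter.1 hω k)).trans hk⟩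
  refine ⟨⋂ k, E k, .iInter hEm, ?_, ?_⟩
  · rw [Set.compl_iInter]
    refine ((measure_iUnion_le _).trans (ENNReal.tsum_le_tsum fun k => ?_)).trans_lt hsum
    simpa using (hEμ k).le
  · exact hcauchy.tendstoUniformlyOn_of_tendsto fun ω hω =>
      (hcauchy.cauchySeq hω).tendsto_limUnder

/-- Half the difference of two elements of an `L∞` ball lies in that ball. -/
theorem half_sub_mem_LinftyBall {Ω : Type*} [MeasurableSpace Ω] {μ : Measure Ω} {d : ℝ}
    {x y : Ω → ℝ} (hx : x ∈ LinftyBall μ d) (hy : y ∈ LinftyBall μ d) :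
    (2⁻¹ : ℝ) • (x - y) ∈ LinftyBall μ d := by
  refine ⟨(hx.1.sub hy.1).const_smul _, ?_⟩
  rw [eLpNorm_const_smul]
  calc ‖(2⁻¹ : ℝ)‖ₑ * eLpNorm (x - y) ⊤ μ
      ≤ 2⁻¹ * (ENNReal.ofReal d + ENNReal.ofReal d) := by
        gcongr
        · rw [enorm_inv two_ne_zero]; simp [Real.enorm_eq_ofReal]
        · exact (eLpNorm_sub_le hx.1.aestronglyMeasurable hy.1.aestronglyMeasurable le_top).trans
            (add_le_add hx.2 hy.2)
    _ = ENNReal.ofReal d := by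
        rw [← two_mul, ← mul_assoc, ENNReal.inv_mul_cancel two_ne_zero ENNReal.ofNat_ne_top,
          one_mul]

/-- An essential bound on `f` over `F` holds almost everywhere on `F`. -/
theorem ae_abs_le_of_eLpNorm_indicator_le {Ω : Type*} [MeasurableSpace Ω] {μ : Measure Ω}
    {F : Set Ω} {f : Ω → ℝ} {δ : ℝ} (hδ : 0 ≤ δ)
    (h : eLpNorm (F.indicator f) ⊤ μ ≤ ENNReal.ofReal δ) :
    ∀ᵐ ω ∂μ, ω ∈ F → |f ω| ≤ δ := by
  rw [eLpNorm_exponent_top] at h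
  filter_upwards [enorm_ae_le_eLpNormEssSup (F.indicator f) μ] with ω hω hωF
  rw [Set.indicator_of_mem hωF, Real.enorm_eq_ofReal_abs] at hω
  exact (ENNReal.ofReal_le_ofReal_iff hδ).1 (hω.trans h)

/-- Commutative case of the paper's Theorem 6: if a sequence of additive maps
`aₙ : L∞ → L⁰` over a probability space is uniformly equicontinuous at `0` on the unit
ball `B₁` of `L∞`, then the set
`C = {x ∈ B₁ : (aₙ(x))ₙ converges almost uniformly}` is closed in `B₁` with respect to
convergence in measure: if `x k ∈ C` for all `k`, `x ∈ B₁` and `x k → x` in measure,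
then `x ∈ C`. -/
theorem theorem6_commutative_case
    {Ω : Type*} [MeasurableSpace Ω] (μ : Measure Ω) [IsProbabilityMeasure μ]
    (a : ℕ → (Ω → ℝ) → Ω → ℝ)
    (hmeas : ∀ n x, Measurable x → eLpNorm x ⊤ μ < ⊤ → Measurable (a n x))
    (hwd : ∀ n x y, Measurable x → Measurable y → eLpNorm x ⊤ μ < ⊤ →
      eLpNorm y ⊤ μ < ⊤ → x =ᵐ[μ] y → a n x =ᵐ[μ] a n y)
    (hadd : ∀ n x y, Measurable x → Measurable y → eLpNorm x ⊤ μ < ⊤ →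
      eLpNorm y ⊤ μ < ⊤ → a n (x + y) =ᵐ[μ] a n x + a n y)
    (hequi : UnifEquicontAtZeroOn μ a (LinftyBall μ 1)) :
    ∀ (u : ℕ → Ω → ℝ) (x : Ω → ℝ),
      (∀ k, u k ∈ LinftyBall μ 1 ∧ ConvergesAU μ (fun n => a n (u k))) →
      x ∈ LinftyBall μ 1 →
      TendstoInMeasure μ u atTop x →
      ConvergesAU μ (fun n => a n x) := by
  intro u x hu hx hux
  have hfin : ∀ {y}, y ∈ LinftyBall μ 1 → eLpNorm y ⊤ μ < ⊤ := fun hy =>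
    hy.2.trans_lt ENNReal.ofReal_lt_top
  refine convergesAU_of_forall_exists_abs_sub_lt fun ε δ hε hδ => ?_
  obtain ⟨γ, η, hγ, hη, H⟩ := hequi (ε / 2) (δ / 8) (by positivity) (by positivity)
  obtain ⟨k, hk⟩ := ((tendstoInMeasure_iff_norm.1 hux (2 * γ) (by positivity)).eventually_lt_const
    (ENNReal.ofReal_pos.2 hη)).exists
  obtain ⟨huk, g, hg⟩ := hu k
  set z : Ω → ℝ := (2⁻¹ : ℝ) • (x - u k) with hz
  have hzB : z ∈ LinftyBall μ 1 := half_sub_mem_LinftyBall hx huk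
  have hsplit : x = u k + (z + z) := by
    ext ω
    simp only [hz, Pi.add_apply, Pi.smul_apply, Pi.sub_apply, smul_eq_mul]
    ring
  have hzz : eLpNorm (z + z) ⊤ μ < ⊤ :=
    (eLpNorm_add_le hzB.1.aestronglyMeasurable hzB.1.aestronglyMeasurable le_top).trans_lt
      (ENNReal.add_lt_top.2 ⟨hfin hzB, hfin hzB⟩)
  obtain ⟨F, hFm, hFμ, hF⟩ := H z hzB <| (measure_mono fun ω hω => by
    simp only [Set.mem_ofPred_eq, hz, Pi.smul_apply, Pi.sub_apply, smul_eq_mul, abs_mul,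
      Real.norm_eq_abs, abs_sub_comm (u k ω)] at hω ⊢
    norm_num at hω
    linarith).trans_lt hk
  obtain ⟨E, hEm, hEμ, hE⟩ := hg (ε / 2) (by positivity)
  obtain ⟨N, hN⟩ := eventually_atTop.1 (Metric.tendstoUniformlyOn_iff.1 hE (δ / 8) (by positivity))
  have hae : ∀ᵐ ω ∂μ, ∀ n, a n x ω = a n (u k) ω + (a n z ω + a n z ω) ∧
      (ω ∈ F → |a n z ω| ≤ δ / 8) := by
    refine ae_all_iff.2 fun n => ?_
    have h₁ := hadd n (u k) (z + z) huk.1 (hzB.1.add hzB.1) (hfin huk) hzz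
    rw [← hsplit] at h₁
    filter_upwards [h₁, hadd n z z hzB.1 hzB.1 (hfin hzB) (hfin hzB),
      ae_abs_le_of_eLpNorm_indicator_le (by positivity)
        ((le_iSup (fun n => eLpNorm (F.indicator (a n z)) ⊤ μ) n).trans hF.le)] with ω h₁ h₂ h₃
    exact ⟨by rw [h₁, Pi.add_apply, h₂, Pi.add_apply], h₃⟩
  obtain ⟨G, hG, hGm, hGμ⟩ := exists_measurable_superset_of_null (ae_iff.1 hae)
  refine ⟨E ∩ F ∩ Gᶜ, (hEm.inter hFm).inter hGm.compl, ?_, N, ?_⟩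
  · rw [Set.compl_inter, Set.compl_inter, compl_compl]
    calc μ (Eᶜ ∪ Fᶜ ∪ G) ≤ μ Eᶜ + μ Fᶜ + μ G :=
          (measure_union_le _ _).trans (add_le_add_left (measure_union_le _ _) _)
      _ = μ Eᶜ + μ Fᶜ := by rw [hGμ, add_zero]
      _ < ENNReal.ofReal (ε / 2) + ENNReal.ofReal (ε / 2) := ENNReal.add_lt_add hEμ hFμ
      _ = ENNReal.ofReal ε := by
          rw [← ENNReal.ofReal_add (by positivity) (by positivity), add_halves]
  · rintro m hm n hn ω ⟨⟨hωE, hωF⟩, hωG⟩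
    have hω := not_not.1 fun hc => hωG (hG hc)
    have h₁ := abs_lt.1 (Real.dist_eq _ _ ▸ hN m hm ω hωE)
    have h₂ := abs_lt.1 (Real.dist_eq _ _ ▸ hN n hn ω hωE)
    have h₃ := abs_le.1 ((hω m).2 hωF)
    have h₄ := abs_le.1 ((hω n).2 hωF)
    rw [(hω m).1, (hω n).1, abs_lt]
    constructor <;> linarith [h₁.1, h₁.2, h₂.1, h₂.2, h₃.1, h₃.2, h₄.1, h₄.2]
end
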